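/- Let k be an algebraically closed field and f₁, …, fₙ ∈ k[t]. For each i let gᵢ(s,t) ∈ k[s,t] be the unique polynomial with fᵢ(t) − fᵢ(s) = (t − s)·gᵢ(s,t). Suppose that at least one of the derivatives f₁′, …, fₙ′ is not the zero polynomial. If V(g₁, …, gₙ) = ∅, then k(f₁, …, fₙ) = k(t), i.e., the subfield of the rational function field k(t) generated over k by f₁, …, fₙ is all of k(t). -/

import Mathlib

open Polynomial MvPolynomial

open scoped TensorProduct

/-- An element `x` of an algebra over a field `K` with `x ⊗ 1 = 1 ⊗ x` is a scalar. -/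
theorem mem_range_algebraMap_of_tmul_one_eq_one_tmul {K A : Type*} [Field K] [Ring A]
    [Nontrivial A] [Algebra K A] {x : A} (h : x ⊗ₜ[K] (1 : A) = (1 : A) ⊗ₜ[K] x) :
    x ∈ (algebraMap K A).range := by
  obtain ⟨l, hl⟩ := (Algebra.linearMap K A).exists_leftInverse_of_injective
    (LinearMap.ker_eq_bot.mpr (algebraMap K A).injective)
  have hl1 : l 1 = 1 := by simpa using LinearMap.congr_fun hl 1
  have hx := congrArg (fun z => TensorProduct.lid K A (l.rTensor A z)) h
  simp only [LinearMap.rTensor_tmul, TensorProduct.lid_tmul, hl1, one_smul] at hx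
  exact ⟨l x, by rw [Algebra.algebraMap_eq_smul_one, hx]⟩

/-- Weak Nullstellensatz: polynomials without a common zero generate the unit ideal. -/
theorem span_range_eq_top_of_forall_exists_eval_ne_zero {k σ ι : Type*} [Field k]
    [IsAlgClosed k] [Finite σ] (g : ι → MvPolynomial σ k)
    (h : ∀ x : σ → k, ∃ i, MvPolynomial.eval x (g i) ≠ 0) :
    Ideal.span (Set.range g) = ⊤ := by
  have hz : zeroLocus k (Ideal.span (Set.range g)) = ∅ := by
    refine Set.eq_empty_of_forall_notMem fun x hx => ?_
    obtain ⟨i, hi⟩ := h x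
    exact hi (by
      simpa [MvPolynomial.aeval_eq_eval] using
        mem_zeroLocus_iff.mp hx (g i) (Ideal.subset_span ⟨i, rfl⟩))
  rw [← Ideal.radical_eq_top, ← vanishingIdeal_zeroLocus_eq_radical (K := k), hz,
    vanishingIdeal_empty]

/-- For an algebraically closed field `k`, with some `fᵢ'` nonzero, if
`V(g₁,…,gₙ) = ∅` then `k(f₁,…,fₙ) = k(t)`. -/
theorem field_adjoin_eq_top_of_zero_set_empty {k : Type*} [Field k] [IsAlgClosed k] {n : ℕ}
    (f : Fin n → Polynomial k) (g : Fin n → MvPolynomial (Fin 2) k)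
    (hg : ∀ i, Polynomial.aeval (MvPolynomial.X 1 : MvPolynomial (Fin 2) k) (f i) -
          Polynomial.aeval (MvPolynomial.X 0 : MvPolynomial (Fin 2) k) (f i) =
          (MvPolynomial.X 1 - MvPolynomial.X 0) * g i)
    (hf : ∃ i, Polynomial.derivative (f i) ≠ 0)
    (hV : {p : k × k | ∀ i, MvPolynomial.eval ![p.1, p.2] (g i) = 0} = ∅) :
    IntermediateField.adjoin k
      (Set.range fun i => algebraMap (Polynomial k) (RatFunc k) (f i)) = ⊤ := by
  set K := IntermediateField.adjoin k
    (Set.range fun i => algebraMap (Polynomial k) (RatFunc k) (f i))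
  have hspan : (1 : MvPolynomial (Fin 2) k) ∈ Ideal.span (Set.range g) := by
    rw [span_range_eq_top_of_forall_exists_eval_ne_zero g fun x => ?_]
    · trivial
    by_contra! hx
    have hmem : (x 0, x 1) ∈ {p : k × k | ∀ i, MvPolynomial.eval ![p.1, p.2] (g i) = 0} := by
      intro i
      rw [← hx i]
      congr 2
      ext j
      fin_cases j <;> rfl
    simp [hV] at hmem
  obtain ⟨c, hc⟩ := Ideal.mem_span_range_iff_exists_fun.mp hspan
  let φ : MvPolynomial (Fin 2) k →ₐ[k] RatFunc k ⊗[K] RatFunc k :=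
    MvPolynomial.aeval ![1 ⊗ₜ RatFunc.X, RatFunc.X ⊗ₜ 1]
  have hleft (p : Polynomial k) : φ (Polynomial.aeval (MvPolynomial.X 1) p) =
      algebraMap (Polynomial k) (RatFunc k) p ⊗ₜ 1 := by
    rw [← Polynomial.aeval_algHom_apply, ← RatFunc.aeval_X_left_eq_algebraMap]
    have := Polynomial.aeval_algHom_apply (Algebra.TensorProduct.includeLeft :
      RatFunc k →ₐ[k] RatFunc k ⊗[K] RatFunc k) RatFunc.X p
    simpa [φ] using this
  have hright (p : Polynomial k) : φ (Polynomial.aeval (MvPolynomial.X 0) p) =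
      1 ⊗ₜ algebraMap (Polynomial k) (RatFunc k) p := by
    rw [← Polynomial.aeval_algHom_apply, ← RatFunc.aeval_X_left_eq_algebraMap]
    have := Polynomial.aeval_algHom_apply ((Algebra.TensorProduct.includeRight :
      RatFunc k →ₐ[K] RatFunc k ⊗[K] RatFunc k).restrictScalars k) RatFunc.X p
    simpa [φ] using this
  have hzero (i : Fin n) : φ ((MvPolynomial.X 1 - MvPolynomial.X 0) * g i) = 0 := by
    have hmem : algebraMap (Polynomial k) (RatFunc k) (f i) ∈ K :=
      IntermediateField.subset_adjoin _ _ ⟨i, rfl⟩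
    rw [← hg, map_sub, hleft, hright, sub_eq_zero]
    simpa [Algebra.smul_def] using
      TensorProduct.smul_tmul (⟨_, hmem⟩ : K) (1 : RatFunc k) (1 : RatFunc k)
  have hdiff : φ (MvPolynomial.X 1 - MvPolynomial.X 0) = 0 := by
    rw [← mul_one (MvPolynomial.X 1 - MvPolynomial.X 0), ← hc, Finset.mul_sum, map_sum]
    refine Finset.sum_eq_zero fun i _ => ?_
    rw [mul_left_comm, map_mul, hzero, mul_zero]
  have htmul : (RatFunc.X : RatFunc k) ⊗ₜ[K] (1 : RatFunc k) = 1 ⊗ₜ RatFunc.X := by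
    simpa [φ, sub_eq_zero] using hdiff
  obtain ⟨y, hy⟩ := mem_range_algebraMap_of_tmul_one_eq_one_tmul htmul
  rw [eq_top_iff, ← RatFunc.adjoin_X, IntermediateField.adjoin_simple_le_iff, ← hy]
  exact y.2
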